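/- arXiv:1303.1647 — 2 statements merged into one kernel-verified Lean document; each statement's English description precedes it below -/
import Mathlib

section
/- Fix γ̄ > 0, ε̄ > 0, γ_th > 0 and ζ > 0. Let γ₁, γ₂ be i.i.d. with density (2/γ̄)e^{−2x/γ̄} on (0,∞) and ε₁, ε₂ i.i.d. exponential with mean ε̄, all four mutually independent. Let F(γ) = 1 if γ > γ_th and F(γ) = 0 otherwise, and select s = 1 if F(γ₁) − F(γ₂) > ζ(ε₂ − ε₁) and s = 2 otherwise (ties in ε₂ − ε₁ = 0 occur with probability zero when F(γ₁) = F(γ₂), in which case s = 1 iff ε₁ > ε₂). Then the average harvested energy of this outage-optimal selection policy equals E[ε_s] = (e^{−4γ_th/γ̄}/2)·[ ε̄ (2 − 2 e^{2γ_th/γ̄} + 3 e^{4γ_th/γ̄}) + (2/ζ)·e^{−1/(ζ ε̄)} (ζ ε̄ + 1)(e^{2γ_th/γ̄} − 1) ]. (Equation (35): the average energy transfer of the Pareto-efficient outage-oriented selection policy; in particular its limit as ζ → 0⁺ is ε̄(3/2 + e^{−4γ_th/γ̄} − e^{−2γ_th/γ̄}).) -/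
open MeasureTheory ProbabilityTheory Real

/-- The joint law of `(γ₁, γ₂, ε₁, ε₂)`: `γ₁, γ₂` are i.i.d. with density
`(2/γ̄)e^{-2x/γ̄}` on `(0,∞)` (exponential with rate `2/γ̄`), `ε₁, ε₂` are i.i.d.
exponential with mean `ε̄` (rate `1/ε̄`), and all four are mutually independent.
A sample point `ω` has `ω.1 = γ₁`, `ω.2.1 = γ₂`, `ω.2.2.1 = ε₁`, `ω.2.2.2 = ε₂`. -/
noncomputable def wdMeasure (γbar εbar : ℝ) : Measure (ℝ × ℝ × ℝ × ℝ) :=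
  (expMeasure (2 / γbar)).prod
    ((expMeasure (2 / γbar)).prod ((expMeasure (1 / εbar)).prod (expMeasure (1 / εbar))))

/-- The no-outage indicator `F(γ) = 1` if `γ > γ_th`, else `0`. -/
noncomputable def noOutage (γth γ : ℝ) : ℝ := if γth < γ then 1 else 0

lemma expMeasure_eq_withDensity_restrict (r : ℝ) :
    expMeasure r = (volume.restrict (Set.Ioi 0)).withDensity
      (fun x => ENNReal.ofReal (r * exp (-(r * x)))) := by
  rw [← withDensity_indicator measurableSet_Ioi]
  refine withDensity_congr_ae ?_
  filter_upwards [Measure.ae_ne volume (0 : ℝ)] with x hx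
  change exponentialPDF r x = _
  rcases lt_or_gt_of_ne hx with h | h
  · rw [exponentialPDF_of_neg h, Set.indicator_of_notMem (by simpa using h.le)]
  · rw [exponentialPDF_of_nonneg h.le, Set.indicator_of_mem (by simpa using h)]

lemma integral_expMeasure {r : ℝ} (hr : 0 < r) (f : ℝ → ℝ) :
    ∫ x, f x ∂(expMeasure r) = ∫ x in Set.Ioi 0, r * exp (-(r * x)) * f x := by
  rw [expMeasure_eq_withDensity_restrict, integral_withDensity_eq_integral_toReal_smul
    (by fun_prop) (by simp)]
  refine integral_congr_ae (ae_of_all _ fun x => ?_)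
  simp only [smul_eq_mul]
  rw [ENNReal.toReal_ofReal (by positivity)]

lemma integrable_expMeasure_iff {r : ℝ} (hr : 0 < r) (f : ℝ → ℝ) :
    Integrable f (expMeasure r) ↔
      IntegrableOn (fun x => r * exp (-(r * x)) * f x) (Set.Ioi 0) := by
  rw [expMeasure_eq_withDensity_restrict, integrable_withDensity_iff_integrable_smul'
    (by fun_prop) (by simp)]
  refine integrable_congr (ae_of_all _ fun x => ?_)
  simp only [smul_eq_mul]
  rw [ENNReal.toReal_ofReal (by positivity)]

lemma expMeasure_singleton (r : ℝ) (x : ℝ) : expMeasure r {x} = 0 := by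
  rw [expMeasure_eq_withDensity_restrict]
  exact withDensity_absolutelyContinuous _ _ (by simp)

lemma hasDerivAt_affine_mul_exp {r : ℝ} (hr : 0 < r) (b x : ℝ) :
    HasDerivAt (fun y => -((y - b + 1 / r) * exp (-(r * y))))
      (r * exp (-(r * x)) * (x - b)) x := by
  have h1 : HasDerivAt (fun y : ℝ => y - b + 1 / r) 1 x :=
    ((hasDerivAt_id x).sub_const b).add_const _
  have h2 : HasDerivAt (fun y : ℝ => exp (-(r * y))) (exp (-(r * x)) * (-(r * 1))) x :=
    (((hasDerivAt_id x).const_mul r).neg).exp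
  refine ((h1.mul h2).neg).congr_deriv ?_
  field_simp
  ring

lemma tendsto_affine_mul_exp {r : ℝ} (hr : 0 < r) (b : ℝ) :
    Filter.Tendsto (fun y => -((y - b + 1 / r) * exp (-(r * y)))) Filter.atTop (nhds 0) := by
  have h0 := tendsto_rpow_mul_exp_neg_mul_atTop_nhds_zero 0 r hr
  have h1 := tendsto_rpow_mul_exp_neg_mul_atTop_nhds_zero 1 r hr
  have h := (h1.add (h0.const_mul (1 / r - b))).neg
  simp only [mul_zero, add_zero, neg_zero] at h
  refine h.congr fun y => ?_
  simp only [rpow_one, rpow_zero, neg_mul]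
  ring

lemma integral_Ioi_affine_mul_exp {r b c : ℝ} (hr : 0 < r) (hbc : b ≤ c) :
    ∫ x in Set.Ioi c, r * exp (-(r * x)) * (x - b) = exp (-(r * c)) * (c - b + 1 / r) := by
  rw [integral_Ioi_of_hasDerivAt_of_nonneg' (fun x _ => hasDerivAt_affine_mul_exp hr b x)
    (fun x hx => ?_) (tendsto_affine_mul_exp hr b)]
  · ring
  · have : 0 ≤ x - b := by have := hx.out; linarith
    positivity

lemma integrable_id_expMeasure {r : ℝ} (hr : 0 < r) :
    Integrable (fun x => x) (expMeasure r) := by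
  rw [integrable_expMeasure_iff hr]
  have := integrableOn_Ioi_deriv_of_nonneg' (a := 0)
    (fun x _ => hasDerivAt_affine_mul_exp hr 0 x) (fun x hx => ?_) (tendsto_affine_mul_exp hr 0)
  · simpa using this
  · have : 0 ≤ x - 0 := by have := hx.out; linarith
    positivity

lemma integral_id_expMeasure {r : ℝ} (hr : 0 < r) : ∫ x, x ∂(expMeasure r) = 1 / r := by
  have := integral_Ioi_affine_mul_exp (b := 0) (c := 0) hr le_rfl
  rw [integral_expMeasure hr]
  simpa using this

lemma integral_ite_lt_expMeasure {r c : ℝ} (hr : 0 < r) (hc : 0 ≤ c) (f : ℝ → ℝ) :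
    ∫ x, (if c < x then f x else 0) ∂(expMeasure r)
      = ∫ x in Set.Ioi c, r * exp (-(r * x)) * f x := by
  rw [integral_expMeasure hr]
  have : ∀ x, r * exp (-(r * x)) * (if c < x then f x else 0)
      = (Set.Ioi c).indicator (fun x => r * exp (-(r * x)) * f x) x := by
    intro x
    by_cases h : c < x <;> simp [h]
  simp_rw [this]
  rw [setIntegral_indicator measurableSet_Ioi, Set.Ioi_inter_Ioi, max_eq_right hc]

lemma integral_noOutage {r t : ℝ} (hr : 0 < r) (ht : 0 ≤ t) :
    ∫ x, noOutage t x ∂(expMeasure r) = exp (-(r * t)) := by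
  simp only [noOutage]
  rw [integral_ite_lt_expMeasure hr ht]
  simp only [mul_one]
  rw [integral_const_mul]
  have := integral_exp_mul_Ioi (a := -r) (by linarith) t
  simp only [neg_mul] at this
  rw [this]
  field_simp

lemma integral_exp_neg_expMeasure {r : ℝ} (hr : 0 < r) :
    ∫ x, exp (-(r * x)) ∂(expMeasure r) = 1 / 2 := by
  rw [integral_expMeasure hr]
  have h := integral_exp_mul_Ioi (a := -(2 * r)) (by linarith) 0
  have e : ∀ x, r * exp (-(r * x)) * exp (-(r * x)) = r * exp (-(2 * r) * x) := by
    intro x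
    rw [mul_assoc, ← exp_add]
    ring_nf
  simp_rw [e]
  rw [integral_const_mul, h]
  simp
  field_simp

lemma integrable_noOutage {r : ℝ} (hr : 0 < r) (t : ℝ) :
    Integrable (noOutage t) (expMeasure r) := by
  have := isProbabilityMeasure_expMeasure hr
  refine (integrable_const (1 : ℝ)).mono' ?_ (ae_of_all _ fun x => ?_)
  · exact (Measurable.ite measurableSet_Ioi measurable_const measurable_const).aestronglyMeasurable
  · unfold noOutage
    split_ifs <;> simp

/-- The selected energy when relay 1 is chosen iff `ε₂ - ε₁ < c`. -/
noncomputable def thresholdSelect (c : ℝ) (z : ℝ × ℝ) : ℝ := if z.2 - z.1 < c then z.1 else z.2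

/-- The gap `ε₂ - ε₁` when it exceeds `c`, and zero otherwise. -/
noncomputable def gapAbove (c : ℝ) (z : ℝ × ℝ) : ℝ := if c < z.2 - z.1 then z.2 - z.1 else 0

lemma integrable_fst_expMeasure_prod {r : ℝ} (hr : 0 < r) :
    Integrable (fun z : ℝ × ℝ => z.1) ((expMeasure r).prod (expMeasure r)) := by
  have := isProbabilityMeasure_expMeasure hr
  exact (integrable_id_expMeasure hr).comp_fst _

lemma integrable_snd_expMeasure_prod {r : ℝ} (hr : 0 < r) :
    Integrable (fun z : ℝ × ℝ => z.2) ((expMeasure r).prod (expMeasure r)) := by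
  have := isProbabilityMeasure_expMeasure hr
  exact (integrable_id_expMeasure hr).comp_snd _

lemma integrable_gapAbove {r : ℝ} (hr : 0 < r) (c : ℝ) :
    Integrable (gapAbove c) ((expMeasure r).prod (expMeasure r)) := by
  refine ((integrable_snd_expMeasure_prod hr).sub (integrable_fst_expMeasure_prod hr)).mono ?_
    (ae_of_all _ fun z => ?_)
  · exact (Measurable.ite (measurableSet_lt (by fun_prop) (by fun_prop)) (by fun_prop)
      (by fun_prop)).aestronglyMeasurable
  · unfold gapAbove
    split_ifs <;> simp

lemma integral_gapAbove {r c : ℝ} (hr : 0 < r) (hc : 0 ≤ c) :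
    ∫ z, gapAbove c z ∂((expMeasure r).prod (expMeasure r))
      = exp (-(r * c)) * (c + 1 / r) / 2 := by
  have := isProbabilityMeasure_expMeasure hr
  rw [integral_prod _ (integrable_gapAbove hr c), integral_expMeasure hr]
  have e : ∀ x ∈ Set.Ioi (0 : ℝ),
      r * exp (-(r * x)) * ∫ y, gapAbove c (x, y) ∂(expMeasure r)
        = r * exp (-(r * x)) * (exp (-(r * x)) * (exp (-(r * c)) * (c + 1 / r))) := by
    intro x hx
    have hx' : 0 < x := hx
    simp only [gapAbove, lt_sub_iff_add_lt]
    rw [integral_ite_lt_expMeasure hr (by linarith),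
      integral_Ioi_affine_mul_exp hr (by linarith), ← mul_assoc (exp (-(r * x))) _, ← exp_add]
    ring_nf
  rw [setIntegral_congr_fun measurableSet_Ioi e, ← integral_expMeasure hr, integral_mul_const,
    integral_exp_neg_expMeasure hr]
  ring

lemma ae_gap_ne {r : ℝ} (hr : 0 < r) (c : ℝ) :
    ∀ᵐ z ∂((expMeasure r).prod (expMeasure r)), z.2 - z.1 ≠ c := by
  have := isProbabilityMeasure_expMeasure hr
  have hm : MeasurableSet {z : ℝ × ℝ | z.2 - z.1 = c} :=
    measurableSet_eq_fun (by fun_prop) (by fun_prop)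
  rw [ae_iff]
  simp only [ne_eq, not_not]
  rw [Measure.measure_prod_null hm]
  refine ae_of_all _ fun x => ?_
  have hx : Prod.mk x ⁻¹' {z : ℝ × ℝ | z.2 - z.1 = c} = {x + c} := by
    ext y
    simp [sub_eq_iff_eq_add']
  simp only [hx, Pi.zero_apply, expMeasure_singleton]

lemma thresholdSelect_ae_eq {r : ℝ} (hr : 0 < r) (c : ℝ) :
    thresholdSelect c =ᵐ[(expMeasure r).prod (expMeasure r)] fun z => z.1 + gapAbove c z := by
  filter_upwards [ae_gap_ne hr c] with z hz
  unfold thresholdSelect gapAbove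
  rcases lt_or_gt_of_ne hz with h | h
  · rw [if_pos h, if_neg h.le.not_gt, add_zero]
  · rw [if_neg h.le.not_gt, if_pos h]
    ring

lemma integrable_thresholdSelect {r : ℝ} (hr : 0 < r) (c : ℝ) :
    Integrable (thresholdSelect c) ((expMeasure r).prod (expMeasure r)) :=
  ((integrable_fst_expMeasure_prod hr).add (integrable_gapAbove hr c)).congr
    (thresholdSelect_ae_eq hr c).symm

lemma integral_thresholdSelect {r c : ℝ} (hr : 0 < r) (hc : 0 ≤ c) :
    ∫ z, thresholdSelect c z ∂((expMeasure r).prod (expMeasure r))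
      = 1 / r + exp (-(r * c)) * (c + 1 / r) / 2 := by
  have := isProbabilityMeasure_expMeasure hr
  rw [integral_congr_ae (thresholdSelect_ae_eq hr c),
    integral_add (integrable_fst_expMeasure_prod hr) (integrable_gapAbove hr c),
    integral_gapAbove hr hc, integral_fun_fst (fun x => x), integral_id_expMeasure hr]
  simp

lemma integral_thresholdSelect_neg {r c : ℝ} (hr : 0 < r) :
    ∫ z, thresholdSelect (-c) z ∂((expMeasure r).prod (expMeasure r))
      = ∫ z, thresholdSelect c z ∂((expMeasure r).prod (expMeasure r)) := by
  have := isProbabilityMeasure_expMeasure hr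
  rw [← integral_prod_swap (thresholdSelect c)]
  refine integral_congr_ae ?_
  filter_upwards [ae_gap_ne hr (-c)] with z hz
  simp only [thresholdSelect, Prod.swap]
  rcases lt_or_gt_of_ne hz with h | h
  · rw [if_pos h, if_neg (by linarith)]
  · rw [if_neg h.le.not_gt, if_pos (by linarith)]

lemma policy_decomposition {γth ζ : ℝ} (hζ : 0 < ζ) (ω : ℝ × ℝ × ℝ × ℝ) :
    (if ζ * (ω.2.2.2 - ω.2.2.1) < noOutage γth ω.1 - noOutage γth ω.2.1
          then ω.2.2.1 else ω.2.2.2)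
      = 1 * (1 * thresholdSelect 0 ω.2.2)
        + noOutage γth ω.1 * ((1 - noOutage γth ω.2.1) *
            (thresholdSelect (1 / ζ) ω.2.2 - thresholdSelect 0 ω.2.2))
        + (1 - noOutage γth ω.1) * (noOutage γth ω.2.1 *
            (thresholdSelect (-(1 / ζ)) ω.2.2 - thresholdSelect 0 ω.2.2)) := by
  have key : ∀ d : ℝ, ζ * (ω.2.2.2 - ω.2.2.1) < d ↔ ω.2.2.2 - ω.2.2.1 < d / ζ := fun d => by
    rw [lt_div_iff₀ hζ, mul_comm]
  simp only [key, noOutage, thresholdSelect]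
  by_cases h1 : γth < ω.1 <;> by_cases h2 : γth < ω.2.1 <;> simp [h1, h2, neg_div]

/-- Equation (35): the average energy transfer of the Pareto-efficient outage-oriented
selection policy, which selects relay 1 iff `F(γ₁) - F(γ₂) > ζ(ε₂ - ε₁)` with `F` the
no-outage indicator. -/
theorem outageOptimal_energy (γbar εbar γth ζ : ℝ) (hγ : 0 < γbar) (hε : 0 < εbar)
    (hγth : 0 < γth) (hζ : 0 < ζ) :
    (∫ ω, (if ζ * (ω.2.2.2 - ω.2.2.1) < noOutage γth ω.1 - noOutage γth ω.2.1
          then ω.2.2.1 else ω.2.2.2) ∂(wdMeasure γbar εbar))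
      = (Real.exp (-4 * γth / γbar) / 2) *
          (εbar * (2 - 2 * Real.exp (2 * γth / γbar) + 3 * Real.exp (4 * γth / γbar))
            + (2 / ζ) * Real.exp (-1 / (ζ * εbar)) * (ζ * εbar + 1) *
                (Real.exp (2 * γth / γbar) - 1)) := by
  have hr : 0 < 2 / γbar := by positivity
  have hs : 0 < 1 / εbar := by positivity
  have := isProbabilityMeasure_expMeasure hr
  have := isProbabilityMeasure_expMeasure hs
  have hF := integrable_noOutage hr γth
  have hF' := (integrable_const (1 : ℝ)).sub hF
  have hT := integrable_thresholdSelect hs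
  have hc : (0 : ℝ) ≤ 1 / ζ := by positivity
  simp_rw [policy_decomposition hζ]
  unfold wdMeasure
  rw [integral_add, integral_add]
  rotate_left
  · exact (integrable_const (1 : ℝ)).mul_prod ((integrable_const (1 : ℝ)).mul_prod (hT 0))
  · exact hF.mul_prod (hF'.mul_prod ((hT _).sub (hT 0)))
  · exact ((integrable_const (1 : ℝ)).mul_prod ((integrable_const (1 : ℝ)).mul_prod (hT 0))).add
      (hF.mul_prod (hF'.mul_prod ((hT _).sub (hT 0))))
  · exact hF'.mul_prod (hF.mul_prod ((hT _).sub (hT 0)))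
  have prod3 : ∀ (f g : ℝ → ℝ) (h : ℝ × ℝ → ℝ),
      ∫ ω : ℝ × ℝ × ℝ × ℝ, f ω.1 * (g ω.2.1 * h ω.2.2) ∂((expMeasure (2 / γbar)).prod
        ((expMeasure (2 / γbar)).prod ((expMeasure (1 / εbar)).prod (expMeasure (1 / εbar)))))
      = (∫ x, f x ∂(expMeasure (2 / γbar))) * ((∫ x, g x ∂(expMeasure (2 / γbar))) *
        ∫ z, h z ∂((expMeasure (1 / εbar)).prod (expMeasure (1 / εbar)))) := fun f g h => by
    rw [integral_prod_mul f (fun w : ℝ × ℝ × ℝ => g w.1 * h w.2), integral_prod_mul g h]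
  rw [prod3 (fun _ => 1) (fun _ => 1) (thresholdSelect 0),
    prod3 (noOutage γth) (fun x => 1 - noOutage γth x)
      (fun z => thresholdSelect (1 / ζ) z - thresholdSelect 0 z),
    prod3 (fun x => 1 - noOutage γth x) (noOutage γth)
      (fun z => thresholdSelect (-(1 / ζ)) z - thresholdSelect 0 z),
    integral_sub (hT _) (hT 0), integral_sub (hT _) (hT 0), integral_thresholdSelect_neg hs,
    integral_sub (integrable_const _) hF, integral_noOutage hr hγth.le,
    integral_thresholdSelect hs hc, integral_thresholdSelect hs le_rfl]
  have e1 : exp (-(2 / γbar * γth)) = (exp (2 * γth / γbar))⁻¹ := by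
    rw [← exp_neg]; ring_nf
  have e2 : exp (-4 * γth / γbar) = (exp (2 * γth / γbar))⁻¹ ^ 2 := by
    rw [← exp_neg, ← exp_nat_mul]; ring_nf
  have e3 : exp (4 * γth / γbar) = exp (2 * γth / γbar) ^ 2 := by
    rw [← exp_nat_mul]; ring_nf
  have e4 : exp (-(1 / εbar * (1 / ζ))) = exp (-1 / (ζ * εbar)) := by
    congr 1; field_simp
  rw [e1, e2, e3, e4]
  have hq := (exp_pos (2 * γth / γbar)).ne'
  simp only [integral_const, probReal_univ, mul_zero, neg_zero, exp_zero, smul_eq_mul]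
  field_simp
  ring
end

section
/- Fix γ̄ > 0, ε̄ > 0, γ_th > 0 and ζ > 0. Let γ₁, γ₂ be i.i.d. with density (2/γ̄)e^{−2x/γ̄} on (0,∞) and ε₁, ε₂ i.i.d. exponential with mean ε̄, all four mutually independent. Let F(γ) = 1 if γ > γ_th and F(γ) = 0 otherwise, and select s = 1 if F(γ₁) − F(γ₂) > ζ(ε₂ − ε₁) and s = 2 otherwise. Then the probability of no outage equals P(γ_s > γ_th) = e^{−4γ_th/γ̄}·[ 2 e^{2γ_th/γ̄} − e^{−1/(ζ ε̄)} (e^{2γ_th/γ̄} − 1) − 1 ]. (Equation (38): the Pareto-optimal probability of no-outage as a function of the Lagrange weight ζ.) -/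
open MeasureTheory ProbabilityTheory Real

section ExponentialTail

variable {r c : ℝ}

instance nullSingletonClass_expMeasure (r : ℝ) : NullSingletonClass (expMeasure r) := by
  unfold expMeasure gammaMeasure
  infer_instance

lemma lintegral_expMeasure (r : ℝ) (f : ℝ → ENNReal) :
    ∫⁻ x, f x ∂expMeasure r = ∫⁻ x, exponentialPDF r x * f x := by
  have hm : Measurable (exponentialPDF r) :=
    (measurable_exponentialPDFReal r).ennreal_ofReal
  exact lintegral_withDensity_eq_lintegral_mul_non_measurable _ hm
    (ae_of_all _ fun _ ↦ ENNReal.ofReal_lt_top) f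

lemma expMeasure_real_Iic (hr : 0 < r) {x : ℝ} (hx : 0 ≤ x) :
    (expMeasure r).real (Set.Iic x) = 1 - exp (-(r * x)) := by
  have := isProbabilityMeasure_expMeasure hr
  rw [← cdf_eq_real, cdf_expMeasure_eq hr, if_pos hx]

lemma expMeasure_real_Ioi (hr : 0 < r) {x : ℝ} (hx : 0 ≤ x) :
    (expMeasure r).real (Set.Ioi x) = exp (-(r * x)) := by
  have := isProbabilityMeasure_expMeasure hr
  rw [← Set.compl_Iic, probReal_compl_eq_one_sub measurableSet_Iic, expMeasure_real_Iic hr hx]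
  ring

lemma expMeasure_Ioi (hr : 0 < r) {x : ℝ} (hx : 0 ≤ x) :
    expMeasure r (Set.Ioi x) = ENNReal.ofReal (exp (-(r * x))) := by
  have := isProbabilityMeasure_expMeasure hr
  rw [← expMeasure_real_Ioi hr hx, ofReal_measureReal]

lemma lintegral_expMeasure_Ioi_add (hr : 0 < r) (hc : 0 ≤ c) :
    ∫⁻ x, expMeasure r (Set.Ioi (x + c)) ∂expMeasure r
      = ENNReal.ofReal (exp (-(r * c)) / 2) := by
  have h (x : ℝ) : exponentialPDF r x * expMeasure r (Set.Ioi (x + c))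
      = ENNReal.ofReal (exp (-(r * c)) / 2) * exponentialPDF (2 * r) x := by
    rcases lt_or_ge x 0 with hx | hx
    · simp [exponentialPDF_of_neg hx]
    · rw [exponentialPDF_of_nonneg hx, exponentialPDF_of_nonneg hx,
        expMeasure_Ioi hr (add_nonneg hx hc), ← ENNReal.ofReal_mul (by positivity),
        ← ENNReal.ofReal_mul (by positivity)]
      congr 1
      rw [show -(r * (x + c)) = -(r * x) + -(r * c) by ring,
        show -(2 * r * x) = -(r * x) + -(r * x) by ring, exp_add, exp_add]
      ring
  rw [lintegral_expMeasure, lintegral_congr h, lintegral_const_mul' _ _ ENNReal.ofReal_ne_top,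
    lintegral_exponentialPDF_eq_one (by positivity), mul_one]

lemma expMeasure_prod_real_sub_lt (hr : 0 < r) (hc : 0 ≤ c) :
    ((expMeasure r).prod (expMeasure r)).real {x | x.2 - x.1 < c}
      = 1 - exp (-(r * c)) / 2 := by
  have := isProbabilityMeasure_expMeasure hr
  have hm : MeasurableSet {x : ℝ × ℝ | x.2 - x.1 < c} :=
    measurableSet_lt (by fun_prop) (by fun_prop)
  have key : ((expMeasure r).prod (expMeasure r)).real {x | x.2 - x.1 < c}ᶜ
      = exp (-(r * c)) / 2 := by
    have h (x : ℝ) : Prod.mk x ⁻¹' {x : ℝ × ℝ | x.2 - x.1 < c}ᶜ = Set.Ici (x + c) := by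
      ext y
      simp [le_sub_iff_add_le, add_comm]
    rw [measureReal_def, Measure.prod_apply hm.compl]
    simp_rw [h, measure_congr Ioi_ae_eq_Ici.symm]
    rw [lintegral_expMeasure_Ioi_add hr hc, ENNReal.toReal_ofReal (by positivity)]
  rw [probReal_compl_eq_one_sub hm] at key
  linarith

lemma expMeasure_prod_real_sub_le (hr : 0 < r) (hc : 0 ≤ c) :
    ((expMeasure r).prod (expMeasure r)).real {x | x.1 - x.2 ≤ c}
      = 1 - exp (-(r * c)) / 2 := by
  have := isProbabilityMeasure_expMeasure hr
  have hm : MeasurableSet {x : ℝ × ℝ | x.1 - x.2 ≤ c} :=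
    measurableSet_le (by fun_prop) (by fun_prop)
  have key : ((expMeasure r).prod (expMeasure r)).real {x | x.1 - x.2 ≤ c}ᶜ
      = exp (-(r * c)) / 2 := by
    have h (y : ℝ) : (fun x ↦ (x, y)) ⁻¹' {x : ℝ × ℝ | x.1 - x.2 ≤ c}ᶜ = Set.Ioi (y + c) := by
      ext x
      simp [add_comm]
    rw [measureReal_def, Measure.prod_apply_symm hm.compl]
    simp_rw [h]
    rw [lintegral_expMeasure_Ioi_add hr hc, ENNReal.toReal_ofReal (by positivity)]
  rw [probReal_compl_eq_one_sub hm] at key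
  linarith

end ExponentialTail

lemma noOutage_event_eq {γth ζ : ℝ} (hζ : 0 < ζ) :
    {ω : ℝ × ℝ × ℝ × ℝ | γth < (if ζ * (ω.2.2.2 - ω.2.2.1) < noOutage γth ω.1 - noOutage γth ω.2.1
        then ω.1 else ω.2.1)}
      = Set.Ioi γth ×ˢ Set.Ioi γth ×ˢ Set.univ
        ∪ (Set.Ioi γth ×ˢ Set.Iic γth ×ˢ {x | x.2 - x.1 < 1 / ζ}
          ∪ Set.Iic γth ×ˢ Set.Ioi γth ×ˢ {x | x.1 - x.2 ≤ 1 / ζ}) := by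
  ext ⟨a, b, x, y⟩
  simp only [noOutage, Set.mem_ofPred_eq, Set.mem_union, Set.mem_prod, Set.mem_Ioi, Set.mem_Iic,
    Set.mem_univ, and_true, lt_div_iff₀' hζ, le_div_iff₀' hζ]
  by_cases ha : γth < a <;> by_cases hb : γth < b
  · simp only [ha, hb, if_true, true_and, true_or, iff_true]
    split_ifs <;> assumption
  · simp [ha, hb, not_lt.1 hb, apply_ite (γth < ·)]
  · have h : ζ * (x - y) ≤ 1 ↔ ¬ ζ * (y - x) < -1 := by
      rw [not_lt]
      constructor <;> intro h <;> linarith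
    simp [ha, hb, not_lt.1 ha, apply_ite (γth < ·), h]
  · simp [ha, hb, apply_ite (γth < ·)]

/-- Equation (38): the Pareto-optimal probability of no-outage `P(γ_s > γ_th)` of the
selection policy which selects relay 1 iff `F(γ₁) - F(γ₂) > ζ(ε₂ - ε₁)` with `F` the
no-outage indicator, as a function of the Lagrange weight `ζ`. -/
theorem outageOptimal_noOutageProb (γbar εbar γth ζ : ℝ) (hγ : 0 < γbar) (hε : 0 < εbar)
    (hγth : 0 < γth) (hζ : 0 < ζ) :
    wdMeasure γbar εbar
        {ω | γth < (if ζ * (ω.2.2.2 - ω.2.2.1) < noOutage γth ω.1 - noOutage γth ω.2.1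
          then ω.1 else ω.2.1)}
      = ENNReal.ofReal
          (Real.exp (-4 * γth / γbar) *
            (2 * Real.exp (2 * γth / γbar)
              - Real.exp (-1 / (ζ * εbar)) * (Real.exp (2 * γth / γbar) - 1) - 1)) := by
  rw [noOutage_event_eq hζ, wdMeasure]
  have hr : 0 < 2 / γbar := by positivity
  have hs : 0 < 1 / εbar := by positivity
  have hc : 0 ≤ 1 / ζ := by positivity
  have := isProbabilityMeasure_expMeasure hr
  have := isProbabilityMeasure_expMeasure hs
  have hm₁ : MeasurableSet {x : ℝ × ℝ | x.2 - x.1 < 1 / ζ} :=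
    measurableSet_lt (by fun_prop) (by fun_prop)
  have hm₂ : MeasurableSet {x : ℝ × ℝ | x.1 - x.2 ≤ 1 / ζ} :=
    measurableSet_le (by fun_prop) (by fun_prop)
  have hIcIo : Disjoint (Set.Iic γth) (Set.Ioi γth) := Set.Iic_disjoint_Ioi le_rfl
  rw [← ofReal_measureReal, measureReal_union, measureReal_union]
  · congr 1
    simp only [measureReal_prod_prod, expMeasure_real_Ioi hr hγth.le,
      expMeasure_real_Iic hr hγth.le, expMeasure_prod_real_sub_lt hs hc,
      expMeasure_prod_real_sub_le hs hc, probReal_univ]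
    rw [show -4 * γth / γbar = -(2 / γbar * γth) + -(2 / γbar * γth) by ring,
      show 2 * γth / γbar = 2 / γbar * γth by ring,
      show -1 / (ζ * εbar) = -(1 / εbar * (1 / ζ)) by field_simp, exp_add, exp_neg (2 / γbar * γth)]
    field_simp
    ring
  · exact Set.disjoint_prod.2 (.inl hIcIo.symm)
  · exact measurableSet_Iic.prod (measurableSet_Ioi.prod hm₂)
  · exact Set.disjoint_union_right.2
      ⟨Set.disjoint_prod.2 (.inr (Set.disjoint_prod.2 (.inl hIcIo.symm))),
        Set.disjoint_prod.2 (.inl hIcIo.symm)⟩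
  · exact (measurableSet_Ioi.prod (measurableSet_Iic.prod hm₁)).union
      (measurableSet_Iic.prod (measurableSet_Ioi.prod hm₂))
end
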